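/- Let r < s < t be computable real numbers with 0 ≤ r. Let A ⊆ {0,1}* be a computably enumerable set of binary strings such that for every n ∈ ℕ the set A_{=n} of strings in A of length n satisfies |A_{=n}| ≤ 2^{rn}. Then the t-gale d' = Σ_{n=0}^∞ 2^{(s−r)n}·d_{A_{=n}} is constructive. -/

import Mathlib

open Filter

/-- The length-`n` prefix `S[0..n-1]` of an infinite binary sequence `S`. -/
def preSeq (S : ℕ → Bool) (n : ℕ) : List Bool := (List.range n).map S

/-- An `s`-supergale: a nonnegative function on binary strings with
    `d w ≥ (d w0 + d w1) / 2^s`. -/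
def Supergale (s : ℝ) (d : List Bool → ℝ) : Prop :=
  (∀ w, 0 ≤ d w) ∧
  ∀ w : List Bool, (d (w ++ [false]) + d (w ++ [true])) / 2 ^ s ≤ d w

/-- An `s`-gale: a nonnegative function on binary strings with
    `d w = (d w0 + d w1) / 2^s`. -/
def Gale (s : ℝ) (d : List Bool → ℝ) : Prop :=
  (∀ w, 0 ≤ d w) ∧
  ∀ w : List Bool, d w = (d (w ++ [false]) + d (w ++ [true])) / 2 ^ s

/-- The success set `S∞[d]`: the sequences on whose prefixes `d` has limsup `∞`. -/
def SuccessSet (d : List Bool → ℝ) : Set (ℕ → Bool) :=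
  {S | limsup (fun n => ((d (preSeq S n) : ℝ) : EReal)) atTop = ⊤}

/-- A real number is computable if some computable rational sequence
    approximates it to within `2 ^ (-n)`. -/
def ComputableReal (r : ℝ) : Prop :=
  ∃ f : ℕ → ℚ, Computable f ∧ ∀ n : ℕ, |(f n : ℝ) - r| ≤ 2 ^ (-(n : ℝ))

/-- A function on binary strings is constructive if it is approximable from
    below by a computable rational function, nondecreasing and strictly below
    `g` in its second argument, with supremum `g w`. -/
def Constructive (g : List Bool → ℝ) : Prop :=
  ∃ h : List Bool × ℕ → ℚ, Computable h ∧
    (∀ w n, h (w, n) ≤ h (w, n + 1) ∧ ((h (w, n) : ℝ) < g w)) ∧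
    ∀ w, g w = ⨆ n : ℕ, ((h (w, n) : ℝ))

/-- The `t`-gale `d_F` determined by a set `F` of strings of length `n`:
    `d_F w = 2^{-t(n-|w|)}·|{v ∈ F : w ⊑ v}|` for `|w| ≤ n`, and
    `d_F w = 2^{(t-1)(|w|-n)}·d_F (w[0..n-1])` for `|w| > n`. -/
noncomputable def dF (t : ℝ) (n : ℕ) (F : Set (List Bool)) (w : List Bool) : ℝ :=
  if w.length ≤ n then
    2 ^ (-t * ((n : ℝ) - (w.length : ℝ))) * ({v ∈ F | w <+: v}.ncard : ℝ)
  else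
    2 ^ ((t - 1) * ((w.length : ℝ) - (n : ℝ))) * ({v ∈ F | w.take n <+: v}.ncard : ℝ)

/-- Unbounded search for a witness of a computable total predicate is computable. -/
theorem computable_nat_find {α : Type*} [Primcodable α] {p : α → ℕ → Bool} (hp : Computable₂ p)
    (hex : ∀ a, ∃ n, p a n = true) : Computable fun a => Nat.find (hex a) := by
  have h : Partrec fun a => Nat.rfind (p a : ℕ →. Bool) := Partrec.rfind hp.partrec₂
  refine Partrec.of_eq h fun a => ?_
  apply Part.eq_some_iff.2
  rw [Nat.mem_rfind]
  refine ⟨?_, fun {m} hm => ?_⟩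
  · simpa using Nat.find_spec (hex a)
  · have := Nat.find_min (hex a) hm
    simpa using this

section OfEncodableOfInfinite

variable {α : Type*} [E : Encodable α] [Infinite α]

theorem exists_encode_ofNat_eq :
    ∃ (_ : Infinite (Set.range (@Encodable.encode α E)))
      (_ : DecidablePred (· ∈ Set.range (@Encodable.encode α E))), ∀ n,
      Encodable.encode (@Denumerable.ofNat α (Denumerable.ofEncodableOfInfinite α) n) =
      (Nat.Subtype.ofNat (Set.range (@Encodable.encode α E)) n : ℕ) := by
  let i1 := Encodable.decidableRangeEncode α
  let i2 : Infinite (Set.range (@Encodable.encode α E)) :=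
    Infinite.of_injective _ (Equiv.ofInjective _ Encodable.encode_injective).injective
  refine ⟨i2, i1, fun n => ?_⟩
  let := Nat.Subtype.denumerable (Set.range (@Encodable.encode α E))
  have key : @Denumerable.ofNat α (Denumerable.ofEncodableOfInfinite α) n =
      (Encodable.equivRangeEncode α).symm
        (Denumerable.ofNat (Set.range (@Encodable.encode α E)) n) :=
    Denumerable.ofEquiv_ofNat _ (Encodable.equivRangeEncode α) n
  have h2 : Denumerable.ofNat (Set.range (@Encodable.encode α E)) n =
      Nat.Subtype.ofNat (Set.range (@Encodable.encode α E)) n :=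
    Denumerable.ofEquiv_ofNat ℕ _ n
  rw [key, h2]
  exact congrArg Subtype.val ((Encodable.equivRangeEncode α).apply_symm_apply _)

theorem isLeast_encode_ofNat_zero :
    IsLeast (Set.range (@Encodable.encode α E))
      (Encodable.encode (@Denumerable.ofNat α (Denumerable.ofEncodableOfInfinite α) 0)) := by
  obtain ⟨_, _, h⟩ := exists_encode_ofNat_eq (α := α)
  refine ⟨⟨_, rfl⟩, fun m hm => ?_⟩
  rw [h]
  exact (bot_le : (⊥ : Set.range (@Encodable.encode α E)) ≤ ⟨m, hm⟩)

theorem isLeast_encode_ofNat_succ (n : ℕ) :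
    IsLeast {m ∈ Set.range (@Encodable.encode α E) |
        Encodable.encode (@Denumerable.ofNat α (Denumerable.ofEncodableOfInfinite α) n) < m}
      (Encodable.encode
        (@Denumerable.ofNat α (Denumerable.ofEncodableOfInfinite α) (n + 1))) := by
  obtain ⟨_, _, h⟩ := exists_encode_ofNat_eq (α := α)
  refine ⟨⟨⟨_, rfl⟩, ?_⟩, fun m hm => ?_⟩
  · rw [h, h]
    exact Nat.Subtype.lt_succ_self _
  · obtain ⟨hm, hlt⟩ := hm
    rw [h] at hlt ⊢
    exact Nat.Subtype.succ_le_of_lt (x := ⟨m, hm⟩) hlt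

end OfEncodableOfInfinite

/-- The sequence of the codes of the rational numbers, in increasing order. -/
def ratCode (n : ℕ) : ℕ :=
  @Encodable.encode ℚ Rat.instEncodable (Denumerable.ofNat ℚ n)

theorem ratCode_eq (n : ℕ) : ratCode n =
    Nat.pair (Equiv.intEquivNat (Denumerable.ofNat ℚ n).num) (Denumerable.ofNat ℚ n).den := rfl

theorem natAbs_eq_intEquivNat (z : ℤ) : z.natAbs = (Equiv.intEquivNat z + 1) / 2 := by
  rcases z with n | n
  · change n = (2 * n + 1) / 2
    omega
  · change n + 1 = (2 * n + 1 + 1) / 2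
    omega

theorem toNat_eq_intEquivNat (z : ℤ) :
    z.toNat = if Equiv.intEquivNat z % 2 = 0 then Equiv.intEquivNat z / 2 else 0 := by
  rcases z with n | n
  · change n = if 2 * n % 2 = 0 then 2 * n / 2 else 0
    simp
  · change 0 = if (2 * n + 1) % 2 = 0 then (2 * n + 1) / 2 else 0
    rw [if_neg (by omega)]

/-- Being the code of a rational number in lowest terms. -/
def IsRatCode (c : ℕ) : Prop :=
  0 < c.unpair.2 ∧ ∀ k < c.unpair.2 + 1,
    ((c.unpair.1 + 1) / 2) % k = 0 → c.unpair.2 % k = 0 → k = 1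

theorem isRatCode_iff (c : ℕ) :
    IsRatCode c ↔ c ∈ Set.range (@Encodable.encode ℚ Rat.instEncodable) := by
  constructor
  · rintro ⟨hpos, h⟩
    obtain ⟨z, hz⟩ := Equiv.intEquivNat.surjective c.unpair.1
    rw [← hz, ← natAbs_eq_intEquivNat] at h
    refine ⟨⟨z, c.unpair.2, hpos.ne', ?_⟩, ?_⟩
    · exact h _ (Nat.lt_succ_of_le (Nat.le_of_dvd hpos (Nat.gcd_dvd_right _ _)))
        (Nat.mod_eq_zero_of_dvd (Nat.gcd_dvd_left _ _))
        (Nat.mod_eq_zero_of_dvd (Nat.gcd_dvd_right _ _))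
    · change Nat.pair (Equiv.intEquivNat z) c.unpair.2 = c
      rw [hz, Nat.pair_unpair]
  · rintro ⟨q, rfl⟩
    change IsRatCode (Nat.pair (Equiv.intEquivNat q.num) q.den)
    unfold IsRatCode
    rw [Nat.unpair_pair, ← natAbs_eq_intEquivNat]
    exact ⟨q.pos, fun k _ h1 h2 => Nat.dvd_one.1 (q.reduced ▸
      Nat.dvd_gcd (Nat.dvd_of_mod_eq_zero h1) (Nat.dvd_of_mod_eq_zero h2))⟩

theorem computable_decide_isRatCode :
    ∃ p : ℕ → Bool, Computable p ∧ ∀ c, p c = true ↔ IsRatCode c := by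
  have hR : PrimrecRel fun k c : ℕ =>
      ((c.unpair.1 + 1) / 2) % k = 0 → c.unpair.2 % k = 0 → k = 1 := by
    have h1 : Primrec fun x : ℕ × ℕ => x.2.unpair.1 :=
      Primrec.fst.comp (Primrec.unpair.comp Primrec.snd)
    have h2 : Primrec fun x : ℕ × ℕ => x.2.unpair.2 :=
      Primrec.snd.comp (Primrec.unpair.comp Primrec.snd)
    have a1 : PrimrecPred fun x : ℕ × ℕ => ((x.2.unpair.1 + 1) / 2) % x.1 = 0 :=
      Primrec.eq.comp (Primrec.nat_mod.comp
        (Primrec.nat_div.comp (Primrec.succ.comp h1) (Primrec.const 2)) Primrec.fst)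
        (Primrec.const 0)
    have a2 : PrimrecPred fun x : ℕ × ℕ => x.2.unpair.2 % x.1 = 0 :=
      Primrec.eq.comp (Primrec.nat_mod.comp h2 Primrec.fst) (Primrec.const 0)
    have a3 : PrimrecPred fun x : ℕ × ℕ => x.1 = 1 :=
      Primrec.eq.comp Primrec.fst (Primrec.const 1)
    have := (a1.not.or (a2.not.or a3))
    refine PrimrecPred.of_eq this fun x => ?_
    tauto
  have hd : Primrec fun c : ℕ => c.unpair.2 := Primrec.snd.comp Primrec.unpair
  have h : PrimrecPred IsRatCode :=
    (Primrec.nat_lt.comp (Primrec.const 0) hd).and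
      (hR.forall_lt.comp (Primrec.succ.comp hd) Primrec.id)
  obtain ⟨_, h⟩ := h
  exact ⟨_, h.to_comp, fun c => by simp⟩

theorem computable_ratCode : Computable ratCode := by
  obtain ⟨p, hp, hpc⟩ := computable_decide_isRatCode
  simp only [isRatCode_iff] at hpc
  have hex : ∀ x : ℕ, ∃ m, (p m && decide (x < m + 1)) = true := by
    intro x
    obtain ⟨m, hm, hlt⟩ := (Set.infinite_range_of_injective
      (@Encodable.encode_injective ℚ Rat.instEncodable)).exists_gt x
    exact ⟨m, by simp [(hpc m).2 hm]; omega⟩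
  have hnext : Computable fun x => Nat.find (hex x) := by
    refine computable_nat_find (p := fun x m => p m && decide (x < m + 1)) ?_ hex
    exact Primrec.and.to_comp.comp (hp.comp Computable.snd)
      (PrimrecPred.decide (Primrec.nat_lt.comp Primrec.fst
        (Primrec.succ.comp Primrec.snd))).to_comp
  have : Computable fun n : ℕ => (Nat.rec (Nat.find (hex 0))
      (fun _ IH => Nat.find (hex (IH + 1))) n : ℕ) :=
    Computable.nat_rec Computable.id (Computable.const _)
      (hnext.comp (Computable.succ.comp (Computable.snd.comp Computable.snd))).to₂
  refine this.of_eq fun n => ?_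
  induction n with
  | zero =>
    have h := isLeast_encode_ofNat_zero (α := ℚ)
    change IsLeast _ (ratCode 0) at h
    refine (Nat.find_eq_iff (hex 0)).2 ⟨by simp [(hpc _).2 h.1], fun m hm hp => ?_⟩
    have := h.2 ((hpc m).1 (by simpa using hp))
    omega
  | succ n ih =>
    have h := isLeast_encode_ofNat_succ (α := ℚ) n
    change IsLeast {m ∈ _ | ratCode n < m} (ratCode (n + 1)) at h
    simp only [ih]
    rw [Nat.find_eq_iff]
    refine ⟨by simpa [(hpc _).2 h.1.1] using h.1.2, fun m hm hp => ?_⟩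
    simp only [Bool.and_eq_true, decide_eq_true_eq] at hp
    have := h.2 ⟨(hpc m).1 hp.1, by omega⟩
    omega

theorem computable_rat_den : Computable fun q : ℚ => q.den := by
  have h : Computable fun q : ℚ => (ratCode (@Encodable.encode ℚ Denumerable.toEncodable q)).unpair.2 :=
    Computable.snd.comp (Computable.unpair.comp (computable_ratCode.comp Computable.encode))
  refine h.of_eq fun q => ?_
  rw [ratCode_eq, Nat.unpair_pair, Denumerable.ofNat_encode]

theorem computable_intEquivNat_num : Computable fun q : ℚ => Equiv.intEquivNat q.num := by
  have h : Computable fun q : ℚ => (ratCode (@Encodable.encode ℚ Denumerable.toEncodable q)).unpair.1 :=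
    Computable.fst.comp (Computable.unpair.comp (computable_ratCode.comp Computable.encode))
  refine h.of_eq fun q => ?_
  rw [ratCode_eq, Nat.unpair_pair, Denumerable.ofNat_encode]

theorem computable_num_toNat : Computable fun q : ℚ => q.num.toNat := by
  have h : Primrec fun n : ℕ => if n % 2 = 0 then n / 2 else 0 :=
    Primrec.ite (Primrec.eq.comp (Primrec.nat_mod.comp Primrec.id (Primrec.const 2))
      (Primrec.const 0)) (Primrec.nat_div.comp Primrec.id (Primrec.const 2)) (Primrec.const 0)
  exact (h.to_comp.comp computable_intEquivNat_num).of_eq fun q => (toNat_eq_intEquivNat _).symm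

theorem computable_num_natAbs : Computable fun q : ℚ => q.num.natAbs := by
  have h : Primrec fun n : ℕ => (n + 1) / 2 :=
    Primrec.nat_div.comp Primrec.succ (Primrec.const 2)
  exact (h.to_comp.comp computable_intEquivNat_num).of_eq fun q => (natAbs_eq_intEquivNat _).symm

/-- The map `(a, b) ↦ (a - 1) / b`, from pairs of natural numbers to rationals, is computable
where `b` is positive. -/
theorem computable_sub_one_div {α : Type*} [Primcodable α] {a b : α → ℕ} (ha : Computable a)
    (hb : Computable b) (hpos : ∀ x, 0 < b x) :
    Computable fun x => ((a x : ℚ) - 1) / b x := by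
  -- `q = (a - 1) / b` as an equation between natural numbers, using `num = 2 * num⁺ - |num|`.
  have hiff : ∀ x (q : ℚ), 2 * q.num.toNat * b x + q.den = a x * q.den + q.num.natAbs * b x ↔
      q = ((a x : ℚ) - 1) / b x := by
    intro x q
    have hb0 : (b x : ℚ) ≠ 0 := by exact_mod_cast (hpos x).ne'
    have hd0 : (q.den : ℚ) ≠ 0 := by exact_mod_cast q.den_nz
    have hnum : q.num = 2 * (q.num.toNat : ℤ) - (q.num.natAbs : ℤ) := by omega
    have hq : q = (2 * (q.num.toNat : ℚ) - (q.num.natAbs : ℚ)) / q.den := by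
      conv_lhs => rw [← Rat.num_div_den q]
      congr 1
      exact_mod_cast hnum
    conv_rhs => rw [hq, div_eq_div_iff hd0 hb0]
    rw [← @Nat.cast_inj ℚ]
    push_cast
    constructor <;> intro h <;> linarith
  have hex : ∀ x, ∃ n, decide (2 * (Denumerable.ofNat ℚ n).num.toNat * b x +
      (Denumerable.ofNat ℚ n).den = a x * (Denumerable.ofNat ℚ n).den +
        (Denumerable.ofNat ℚ n).num.natAbs * b x) = true := fun x =>
    ⟨@Encodable.encode ℚ Denumerable.toEncodable (((a x : ℚ) - 1) / b x), by
      rw [Denumerable.ofNat_encode, decide_eq_true_eq, hiff]⟩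
  have hfind := computable_nat_find (p := fun x n =>
    decide (2 * (Denumerable.ofNat ℚ n).num.toNat * b x +
      (Denumerable.ofNat ℚ n).den = a x * (Denumerable.ofNat ℚ n).den +
        (Denumerable.ofNat ℚ n).num.natAbs * b x)) ?_ hex
  · refine ((Computable.ofNat ℚ).comp hfind).of_eq fun x => ?_
    have := Nat.find_spec (hex x)
    rwa [decide_eq_true_eq, hiff] at this
  · have hq : Computable fun y : α × ℕ => Denumerable.ofNat ℚ y.2 :=
      (Computable.ofNat ℚ).comp Computable.snd
    have ha' : Computable fun y : α × ℕ => a y.1 := ha.comp Computable.fst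
    have hb' : Computable fun y : α × ℕ => b y.1 := hb.comp Computable.fst
    have hmul := Primrec.nat_mul.to_comp
    have hadd := Primrec.nat_add.to_comp
    have heq : Computable₂ fun m n : ℕ => decide (m = n) :=
      (PrimrecPred.decide (Primrec.eq (α := ℕ))).to_comp
    exact heq.comp
      (hadd.comp (hmul.comp (hmul.comp (Computable.const 2) (computable_num_toNat.comp hq)) hb')
        (computable_rat_den.comp hq))
      (hadd.comp (hmul.comp ha' (computable_rat_den.comp hq))
        (hmul.comp (computable_num_natAbs.comp hq) hb'))

theorem primrec_nat_pow : Primrec₂ ((· ^ ·) : ℕ → ℕ → ℕ) :=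
  Primrec₂.unpaired'.1 Nat.Primrec.pow

/-- A nonnegative computable real is approximated by computable dyadic rationals with
natural numerators. -/
theorem ComputableReal.exists_nat_approx {r : ℝ} (h : ComputableReal r) (hr : 0 ≤ r) :
    ∃ R : ℕ → ℕ, Computable R ∧ ∀ n, |(R n : ℝ) - r * 2 ^ n| ≤ 2 := by
  obtain ⟨f, hf, hfr⟩ := h
  refine ⟨fun n => (f n).num.toNat * 2 ^ n / (f n).den, ?_, fun n => ?_⟩
  · exact Primrec.nat_div.to_comp.comp
      (Primrec.nat_mul.to_comp.comp (computable_num_toNat.comp hf)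
        (primrec_nat_pow.to_comp.comp (Computable.const 2) Computable.id))
      (computable_rat_den.comp hf)
  have hq := hfr n
  set q := f n
  have hd : (0 : ℝ) < q.den := by exact_mod_cast q.pos
  have h2 : (0 : ℝ) < 2 ^ n := by positivity
  have hmax : ((q.num.toNat : ℝ) / q.den) = max (q : ℝ) 0 := by
    have hqr : (q : ℝ) = (q.num : ℝ) / q.den := by exact_mod_cast (Rat.num_div_den q).symm
    have : (q.num.toNat : ℝ) = max (q.num : ℝ) 0 := by exact_mod_cast Int.toNat_eq_max q.num
    rw [this, hqr, ← max_div_div_right hd.le, zero_div]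
  have hpow : (2 : ℝ) ^ (-(n : ℝ)) * 2 ^ n = 1 := by
    rw [Real.rpow_neg zero_le_two, Real.rpow_natCast, inv_mul_cancel₀ h2.ne']
  have habs : |((q.num.toNat : ℝ) / q.den) - r| ≤ 2 ^ (-(n : ℝ)) := by
    rw [hmax]
    refine le_trans ?_ hq
    have := abs_max_sub_max_le_abs (q : ℝ) r 0
    rwa [max_eq_left hr] at this
  have hx : |(q.num.toNat : ℝ) * 2 ^ n / q.den - r * 2 ^ n| ≤ 1 := by
    have : (q.num.toNat : ℝ) * 2 ^ n / q.den - r * 2 ^ n =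
        ((q.num.toNat : ℝ) / q.den - r) * 2 ^ n := by ring
    rw [this, abs_mul, abs_of_pos h2, ← hpow]
    gcongr
  have hfl : ((q.num.toNat * 2 ^ n / q.den : ℕ) : ℝ) =
      (⌊(q.num.toNat : ℝ) * 2 ^ n / q.den⌋₊ : ℝ) := by
    have := Nat.floor_div_eq_div (K := ℝ) (q.num.toNat * 2 ^ n) q.den
    push_cast at this
    rw [this]
  have h0 : (0 : ℝ) ≤ (q.num.toNat : ℝ) * 2 ^ n / q.den := by positivity
  have l1 := Nat.floor_le h0
  have l2 := Nat.lt_floor_add_one ((q.num.toNat : ℝ) * 2 ^ n / q.den)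
  rw [hfl]
  rw [abs_le] at hx ⊢
  constructor <;> linarith

/-- The largest `m` with `m ^ 2 ^ N < 2 ^ K`, a lower approximation of `2 ^ (K / 2 ^ N)`. -/
def dyadicRoot (K N : ℕ) : ℕ := Nat.findGreatest (fun m => m ^ 2 ^ N < 2 ^ K) (2 ^ K)

theorem primrec_dyadicRoot : Primrec₂ dyadicRoot := by
  have h2 : Primrec fun x : (ℕ × ℕ) × ℕ => 2 ^ x.1.1 :=
    primrec_nat_pow.comp (Primrec.const 2) (Primrec.fst.comp Primrec.fst)
  have hrel : PrimrecRel fun (x : ℕ × ℕ) (m : ℕ) => m ^ 2 ^ x.2 < 2 ^ x.1 :=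
    Primrec.nat_lt.comp (primrec_nat_pow.comp Primrec.snd
      (primrec_nat_pow.comp (Primrec.const 2) (Primrec.snd.comp Primrec.fst))) h2
  exact Primrec.nat_findGreatest (primrec_nat_pow.comp (Primrec.const 2) Primrec.fst) hrel

theorem dyadicRoot_pow_lt (K N : ℕ) : dyadicRoot K N ^ 2 ^ N < 2 ^ K :=
  Nat.findGreatest_spec (P := fun m => m ^ 2 ^ N < 2 ^ K) (Nat.zero_le _) (by
    rw [zero_pow (by positivity)]
    positivity)

theorem dyadicRoot_zero (N : ℕ) : dyadicRoot 0 N = 0 := by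
  have h := dyadicRoot_pow_lt 0 N
  rw [pow_zero, Nat.lt_one_iff] at h
  exact eq_zero_of_pow_eq_zero h

theorem le_dyadicRoot_succ_pow (K N : ℕ) : 2 ^ K ≤ (dyadicRoot K N + 1) ^ 2 ^ N := by
  by_contra! h
  have hle : dyadicRoot K N + 1 ≤ 2 ^ K :=
    (Nat.le_self_pow (by positivity) _).trans h.le
  have := Nat.le_findGreatest (P := fun m => m ^ 2 ^ N < 2 ^ K) hle h
  exact absurd this (Nat.not_succ_le_self _)

theorem two_rpow_div_pow (K N : ℕ) : ((2 : ℝ) ^ ((K : ℝ) / 2 ^ N)) ^ 2 ^ N = 2 ^ K := by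
  rw [← Real.rpow_natCast, ← Real.rpow_mul zero_le_two]
  push_cast
  rw [div_mul_cancel₀ _ (by positivity), Real.rpow_natCast]

theorem dyadicRoot_le (K N : ℕ) : (dyadicRoot K N : ℝ) ≤ 2 ^ ((K : ℝ) / 2 ^ N) := by
  refine le_of_pow_le_pow_left₀ (n := 2 ^ N) (by positivity) (by positivity) ?_
  rw [two_rpow_div_pow]
  exact_mod_cast (dyadicRoot_pow_lt K N).le

theorem le_dyadicRoot_add_one (K N : ℕ) : (2 : ℝ) ^ ((K : ℝ) / 2 ^ N) ≤ dyadicRoot K N + 1 := by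
  refine le_of_pow_le_pow_left₀ (n := 2 ^ N) (by positivity) (by positivity) ?_
  rw [two_rpow_div_pow]
  exact_mod_cast le_dyadicRoot_succ_pow K N

theorem dyadicRoot_div_le {P Q N : ℕ} {e : ℝ} (h : (P : ℝ) - Q ≤ (e + N) * 2 ^ N) :
    (dyadicRoot (P - Q) N : ℝ) / 2 ^ N ≤ 2 ^ e := by
  rcases le_or_gt P Q with hPQ | hPQ
  · rw [Nat.sub_eq_zero_of_le hPQ, dyadicRoot_zero]
    simp only [Nat.cast_zero, zero_div]
    positivity
  · rw [div_le_iff₀ (by positivity), ← Real.rpow_natCast 2 N, ← Real.rpow_add zero_lt_two]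
    refine (dyadicRoot_le _ _).trans (Real.rpow_le_rpow_of_exponent_le one_le_two ?_)
    rw [Nat.cast_sub hPQ.le, div_le_iff₀ (by positivity)]
    exact h

theorem le_dyadicRoot_div {P Q N : ℕ} {e C : ℝ} (h : (e + N) * 2 ^ N - C ≤ (P : ℝ) - Q) :
    (2 : ℝ) ^ (e - C * (1 / 2) ^ N) - (1 / 2) ^ N ≤ (dyadicRoot (P - Q) N : ℝ) / 2 ^ N := by
  have h2 : (0 : ℝ) < 2 ^ N := by positivity
  rw [le_div_iff₀ h2, sub_mul, one_div, inv_pow, inv_mul_cancel₀ h2.ne',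
    ← Real.rpow_natCast 2 N, ← Real.rpow_add zero_lt_two, Real.rpow_natCast,
    sub_le_iff_le_add]
  refine le_trans (Real.rpow_le_rpow_of_exponent_le one_le_two ?_) (le_dyadicRoot_add_one _ _)
  rw [le_div_iff₀ h2]
  have h1 : (P : ℝ) - Q ≤ ((P - Q : ℕ) : ℝ) := by
    rw [sub_le_iff_le_add]
    exact_mod_cast Nat.sub_le_iff_le_add.1 le_rfl
  refine le_trans (le_of_eq ?_) (h.trans h1)
  field_simp
  ring

theorem tendsto_dyadicRoot_div {P Q : ℕ → ℕ} {e C : ℝ}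
    (hup : ∀ N : ℕ, (P N : ℝ) - Q N ≤ (e + N) * 2 ^ N)
    (hlow : ∀ N : ℕ, (e + N) * 2 ^ N - C ≤ (P N : ℝ) - Q N) :
    Tendsto (fun N => (dyadicRoot (P N - Q N) N : ℝ) / 2 ^ N) atTop (nhds (2 ^ e)) := by
  have hz : Tendsto (fun N : ℕ => ((1 : ℝ) / 2) ^ N) atTop (nhds 0) :=
    tendsto_pow_atTop_nhds_zero_of_lt_one (by norm_num) (by norm_num)
  have hlim : Tendsto (fun N : ℕ => (2 : ℝ) ^ (e - C * (1 / 2) ^ N) - (1 / 2) ^ N) atTop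
      (nhds (2 ^ (e - C * 0) - 0)) :=
    (((Real.continuous_const_rpow two_ne_zero).tendsto _).comp
      (tendsto_const_nhds.sub (hz.const_mul C))).sub hz
  rw [mul_zero, sub_zero, sub_zero] at hlim
  exact tendsto_of_tendsto_of_tendsto_of_le_of_le hlim tendsto_const_nhds
    (fun N => le_dyadicRoot_div (hlow N)) (fun N => dyadicRoot_div_le (hup N))

/-- A function with computable dyadic lower approximations `T (w, N) / 2 ^ N` that come
arbitrarily close to it is constructive. -/
theorem constructive_of_dyadic_approx {g : List Bool → ℝ} {T : List Bool × ℕ → ℕ}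
    (hT : Computable T) (hle : ∀ w N, (T (w, N) : ℝ) / 2 ^ N ≤ g w)
    (hlim : ∀ w, ∀ ε > 0, ∃ N, g w - ε < (T (w, N) : ℝ) / 2 ^ N) : Constructive g := by
  obtain ⟨S, hS0, hS1⟩ : ∃ S : List Bool → ℕ → ℕ, (∀ w, S w 0 = T (w, 0)) ∧
      ∀ w n, S w (n + 1) = max (2 * S w n) (T (w, n + 1)) :=
    ⟨fun w n => Nat.rec (T (w, 0)) (fun k IH => max (2 * IH) (T (w, k + 1))) n,
      fun _ => rfl, fun _ _ => rfl⟩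
  have hS : Computable fun x : List Bool × ℕ => S x.1 x.2 := by
    have h : Computable fun x : List Bool × ℕ =>
        (Nat.rec (T (x.1, 0)) (fun k IH => max (2 * IH) (T (x.1, k + 1))) x.2 : ℕ) :=
      Computable.nat_rec (h := fun x p => max (2 * p.2) (T (x.1, p.1 + 1))) Computable.snd
        (hT.comp (Computable.fst.pair (Computable.const 0)))
        (Primrec.nat_max.to_comp.comp
          (Primrec.nat_mul.to_comp.comp (Computable.const 2)
            (Computable.snd.comp Computable.snd))
          (hT.comp ((Computable.fst.comp Computable.fst).pair
            (Computable.succ.comp (Computable.fst.comp Computable.snd)))))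
    refine h.of_eq fun x => ?_
    induction x.2 with
    | zero => exact (hS0 _).symm
    | succ n ih => rw [hS1, ← ih]
  have hS2 : ∀ w n, 2 * S w n ≤ S w (n + 1) := fun w n => hS1 w n ▸ le_max_left _ _
  have hTS : ∀ w n, T (w, n) ≤ S w n := by
    rintro w (_ | n)
    · exact (hS0 w).ge
    · exact hS1 w n ▸ le_max_right _ _
  have hSg : ∀ w n, (S w n : ℝ) / 2 ^ n ≤ g w := by
    intro w n
    induction n with
    | zero => exact hS0 w ▸ hle w 0
    | succ n ih =>
      rcases max_choice (2 * S w n) (T (w, n + 1)) with h | h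
      · have : S w (n + 1) = 2 * S w n := (hS1 w n).trans h
        rw [this]
        push_cast
        rw [pow_succ', mul_div_mul_left _ _ two_ne_zero]
        exact ih
      · have : S w (n + 1) = T (w, n + 1) := (hS1 w n).trans h
        rw [this]
        exact hle w _
  have hmono : ∀ w, Monotone fun n => (S w n : ℝ) / 2 ^ n := fun w =>
    monotone_nat_of_le_succ fun n => by
      rw [div_le_div_iff₀ (by positivity) (by positivity), pow_succ']
      have : (2 * S w n : ℝ) ≤ S w (n + 1) := by exact_mod_cast hS2 w n
      have h2 : (0 : ℝ) < 2 ^ n := by positivity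
      nlinarith
  have hcast : ∀ w n, (((((S w n : ℕ) : ℚ) - 1) / ((2 ^ n : ℕ) : ℚ) : ℚ) : ℝ) =
      (S w n : ℝ) / 2 ^ n - (1 / 2) ^ n := by
    intro w n
    push_cast
    rw [sub_div, one_div_pow]
  have hlt : ∀ w n, (((((S w n : ℕ) : ℚ) - 1) / ((2 ^ n : ℕ) : ℚ) : ℚ) : ℝ) < g w := by
    intro w n
    rw [hcast]
    have : (0 : ℝ) < (1 / 2) ^ n := by positivity
    linarith [hSg w n]
  refine ⟨fun x => (((S x.1 x.2 : ℕ) : ℚ) - 1) / ((2 ^ x.2 : ℕ) : ℚ), ?_, fun w n => ⟨?_, hlt w n⟩,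
    fun w => ?_⟩
  · exact computable_sub_one_div hS
      (primrec_nat_pow.to_comp.comp (Computable.const 2) Computable.snd)
      (fun x => by positivity)
  · rw [← Rat.cast_le (K := ℝ)]
    refine (hcast w n).le.trans (le_trans ?_ (hcast w (n + 1)).ge)
    have h1 : (S w n : ℝ) / 2 ^ n ≤ (S w (n + 1) : ℝ) / 2 ^ (n + 1) := hmono w n.le_succ
    have h2 : ((1 : ℝ) / 2) ^ (n + 1) ≤ (1 / 2) ^ n :=
      pow_le_pow_of_le_one (by norm_num) (by norm_num) n.le_succ
    linarith
  · symm
    refine ciSup_eq_of_forall_le_of_forall_lt_exists_gt (fun n => (hlt w n).le) fun x hx => ?_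
    obtain ⟨N, hN⟩ := hlim w ((g w - x) / 2) (by linarith)
    obtain ⟨k, hk⟩ := exists_pow_lt_of_lt_one (show 0 < (g w - x) / 2 by linarith)
      (show (1 / 2 : ℝ) < 1 by norm_num)
    refine ⟨max N k, ?_⟩
    refine lt_of_lt_of_eq ?_ (hcast w (max N k)).symm
    have h1 : (S w N : ℝ) / 2 ^ N ≤ (S w (max N k) : ℝ) / 2 ^ (max N k) :=
      hmono w (le_max_left _ _)
    have h2 : ((1 : ℝ) / 2) ^ (max N k) ≤ (1 / 2) ^ k :=
      pow_le_pow_of_le_one (by norm_num) (by norm_num) (le_max_right _ _)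
    have h3 : (T (w, N) : ℝ) / 2 ^ N ≤ (S w N : ℝ) / 2 ^ N := by
      gcongr
      exact_mod_cast hTS w N
    linarith

/-- The sum of the values of `m` at the elements of `α` with code below `N`. -/
def sumCodesLT {α : Type*} [Encodable α] (m : α → ℕ) (N : ℕ) : ℕ :=
  ∑ i ∈ Finset.range N, (Encodable.decode₂ α i).elim 0 m

section SumCodesLT

variable {α : Type*} [Encodable α] {f : α → ℝ} {m : α → ℕ → ℕ}

theorem HasSum.decode₂ {a : ℝ} (hf : HasSum f a) :
    HasSum (fun i => (Encodable.decode₂ α i).elim 0 f) a := by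
  rw [← (Encodable.encode_injective (α := α)).hasSum_iff]
  · convert hf using 1
    exact funext fun x => congrArg (Option.elim · 0 f) (Encodable.decode₂_encode x)
  · intro i hi
    rw [Option.eq_none_iff_forall_not_mem.2 fun x hx => hi ⟨x, Encodable.mem_decode₂.1 hx⟩]
    rfl

theorem sumCodesLT_div (N : ℕ) : (sumCodesLT (fun v => m v N) N : ℝ) / 2 ^ N =
    ∑ i ∈ Finset.range N, (Encodable.decode₂ α i).elim 0 (fun v => (m v N : ℝ) / 2 ^ N) := by
  rw [sumCodesLT, Nat.cast_sum, Finset.sum_div]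
  refine Finset.sum_congr rfl fun i _ => ?_
  cases Encodable.decode₂ α i <;> simp

theorem sumCodesLT_div_le (hf : Summable f) (h0 : ∀ v, 0 ≤ f v)
    (hle : ∀ v N, (m v N : ℝ) / 2 ^ N ≤ f v) (N : ℕ) :
    (sumCodesLT (fun v => m v N) N : ℝ) / 2 ^ N ≤ ∑' v, f v := by
  rw [sumCodesLT_div]
  refine le_trans (Finset.sum_le_sum fun i _ => ?_)
    (sum_le_hasSum (Finset.range N) (fun i _ => ?_) hf.hasSum.decode₂)
  · cases Encodable.decode₂ α i
    · exact le_rfl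
    · exact hle _ _
  · cases Encodable.decode₂ α i
    · exact le_rfl
    · exact h0 _

theorem exists_lt_sumCodesLT_div (hf : Summable f)
    (hlim : ∀ v, Tendsto (fun N => (m v N : ℝ) / 2 ^ N) atTop (nhds (f v))) {ε : ℝ} (hε : 0 < ε) :
    ∃ N, ∑' v, f v - ε < (sumCodesLT (fun v => m v N) N : ℝ) / 2 ^ N := by
  obtain ⟨K, hK⟩ := (hf.hasSum.decode₂.tendsto_sum_nat.eventually
    (lt_mem_nhds (show ∑' v, f v - ε < ∑' v, f v by linarith))).exists
  have ht : Tendsto (fun N => ∑ i ∈ Finset.range K,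
      (Encodable.decode₂ α i).elim 0 (fun v => (m v N : ℝ) / 2 ^ N)) atTop
      (nhds (∑ i ∈ Finset.range K, (Encodable.decode₂ α i).elim 0 f)) := by
    refine tendsto_finsetSum _ fun i _ => ?_
    cases Encodable.decode₂ α i
    · exact tendsto_const_nhds
    · exact hlim _
  obtain ⟨N, hN, hKN⟩ := ((ht.eventually (lt_mem_nhds hK)).and (eventually_ge_atTop K)).exists
  refine ⟨N, hN.trans_le ?_⟩
  rw [sumCodesLT_div]
  refine Finset.sum_le_sum_of_subset_of_nonneg
    (Finset.range_subset_range.2 hKN) fun i _ _ => ?_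
  cases Encodable.decode₂ α i
  · exact le_rfl
  · simp only [Option.elim_some]
    positivity

end SumCodesLT

theorem computable_sumCodesLT {α β : Type*} [Primcodable α] [Primcodable β] {m : β → α → ℕ}
    {n : β → ℕ} (hm : Computable₂ m) (hn : Computable n) :
    Computable fun b => sumCodesLT (m b) (n b) := by
  have h : Computable fun b => (Nat.rec 0
      (fun i IH => IH + (Encodable.decode₂ α i).elim 0 (m b)) (n b) : ℕ) := by
    refine Computable.nat_rec hn (Computable.const 0)
      (h := fun b p => p.2 + (Encodable.decode₂ α p.1).elim 0 (m b)) ?_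
    refine Primrec.nat_add.to_comp.comp (Computable.snd.comp Computable.snd) ?_
    refine (Computable.option_casesOn (Primrec.decode₂.to_comp.comp
      (Computable.fst.comp Computable.snd)) (Computable.const 0)
      (hm.comp (Computable.fst.comp Computable.fst) Computable.snd).to₂).of_eq fun x => ?_
    cases Encodable.decode₂ α x.2.1 <;> rfl
  refine h.of_eq fun b => ?_
  induction n b with
  | zero => rfl
  | succ k ih => simp only [sumCodesLT, Finset.sum_range_succ] at ih ⊢; rw [ih]

theorem computable_any_range {α : Type*} [Primcodable α] {F : α × ℕ → Bool} {n : α → ℕ}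
    (hF : Computable F) (hn : Computable n) :
    Computable fun a => (List.range (n a)).any fun j => F (a, j) := by
  have h : Computable fun a => (Nat.rec false (fun j IH => IH || F (a, j)) (n a) : Bool) :=
    Computable.nat_rec hn (Computable.const false)
      (Primrec.or.to_comp.comp (Computable.snd.comp Computable.snd)
        (hF.comp (Computable.fst.pair (Computable.fst.comp Computable.snd)))).to₂
  refine h.of_eq fun a => ?_
  induction n a with
  | zero => rfl
  | succ k ih => simp [List.range_succ, ih]

/-- The exponent of the weight that a string `v` contributes at `w` to the sum of the
gales `2 ^ ((s - r) * n) * dF t n F`. -/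
def weightExponent (r s t : ℝ) (w v : List Bool) : ℝ :=
  s * v.length + t * w.length -
    (r * v.length + t * v.length + ((w.length - v.length : ℕ) : ℝ))

open Classical in
/-- The contribution of a string `v` at `w` to `∑ n, 2 ^ ((s - r) * n) * dF t n A_{=n}`. -/
noncomputable def weight (r s t : ℝ) (A : Set (List Bool)) (w v : List Bool) : ℝ :=
  if v ∈ A ∧ w.take v.length = v.take w.length then 2 ^ weightExponent r s t w v else 0

theorem weight_nonneg (r s t : ℝ) (A : Set (List Bool)) (w v : List Bool) :
    0 ≤ weight r s t A w v := by
  unfold weight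
  split_ifs <;> positivity

/-- The binary strings of length `n`, as a finset. -/
noncomputable def stringsOfLength (n : ℕ) : Finset (List Bool) :=
  (List.finite_length_eq Bool n).toFinset

theorem mem_stringsOfLength {n : ℕ} {v : List Bool} : v ∈ stringsOfLength n ↔ v.length = n := by
  simp [stringsOfLength]

theorem tsum_length_fiber (f : List Bool → ℝ) (n : ℕ) :
    ∑' v : (List.length ⁻¹' {n} : Set (List Bool)), f v = ∑ v ∈ stringsOfLength n, f v := by
  rw [← Finset.tsum_subtype']
  have : (List.length ⁻¹' {n} : Set (List Bool)) = (stringsOfLength n : Set (List Bool)) := by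
    ext v
    simp [mem_stringsOfLength]
  rw [this]

theorem summable_of_summable_length {f : List Bool → ℝ} (h0 : ∀ v, 0 ≤ f v)
    (h : Summable fun n => ∑ v ∈ stringsOfLength n, f v) : Summable f := by
  refine (summable_partition (s := fun n => List.length ⁻¹' {n}) h0
    (fun v => ⟨v.length, rfl, fun _ h => h.symm⟩)).2 ⟨fun n => ?_, ?_⟩
  · have : Finite (List.length ⁻¹' {n} : Set (List Bool)) := List.finite_length_eq Bool n
    exact Summable.of_finite
  · simpa only [tsum_length_fiber] using h

theorem tsum_sum_stringsOfLength {f : List Bool → ℝ} (h : Summable f) :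
    ∑' n, ∑ v ∈ stringsOfLength n, f v = ∑' v, f v := by
  have := (h.hasSum.tsum_fiberwise List.length).tsum_eq
  simpa only [tsum_length_fiber] using this

theorem ncard_eq_sum (A : Set (List Bool)) (n : ℕ) (p : List Bool → Prop) (c : ℝ)
    [DecidablePred fun v => v ∈ A ∧ p v] :
    c * ({v ∈ {v ∈ A | v.length = n} | p v}.ncard : ℝ) =
      ∑ v ∈ stringsOfLength n, if v ∈ A ∧ p v then c else 0 := by
  have : {v ∈ {v ∈ A | v.length = n} | p v} =
      ((stringsOfLength n).filter fun v => v ∈ A ∧ p v : Set (List Bool)) := by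
    ext v
    simp only [Set.mem_ofPred_eq, Finset.coe_filter, mem_stringsOfLength]
    tauto
  rw [this, Set.ncard_coe_finset, ← Finset.sum_filter, Finset.sum_const, nsmul_eq_mul, mul_comm]

theorem mul_dF_eq_sum_weight (r s t : ℝ) (A : Set (List Bool)) (w : List Bool) (n : ℕ) :
    2 ^ ((s - r) * n) * dF t n {v ∈ A | v.length = n} w =
      ∑ v ∈ stringsOfLength n, weight r s t A w v := by
  classical
  unfold dF
  split_ifs with hn
  · rw [← mul_assoc, ← Real.rpow_add zero_lt_two, ncard_eq_sum]
    refine Finset.sum_congr rfl fun v hv => ?_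
    rw [mem_stringsOfLength] at hv
    subst hv
    refine if_congr (and_congr_right' ?_) (congrArg _ ?_) rfl
    · rw [List.take_of_length_le hn, ← List.prefix_iff_eq_take]
    · rw [weightExponent, Nat.sub_eq_zero_of_le hn]
      push_cast
      ring
  · push Not at hn
    rw [← mul_assoc, ← Real.rpow_add zero_lt_two, ncard_eq_sum]
    refine Finset.sum_congr rfl fun v hv => ?_
    rw [mem_stringsOfLength] at hv
    subst hv
    refine if_congr (and_congr_right' ?_) (congrArg _ ?_) rfl
    · rw [List.prefix_iff_eq_take, List.length_take, min_eq_left hn.le,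
        List.take_of_length_le hn.le, List.take_length]
    · rw [weightExponent, Nat.cast_sub hn.le]
      ring

theorem summable_sum_weight {r s t : ℝ} (hst : s < t) {A : Set (List Bool)}
    (hcard : ∀ n : ℕ, (({w ∈ A | w.length = n}).ncard : ℝ) ≤ 2 ^ (r * n)) (w : List Bool) :
    Summable fun n => ∑ v ∈ stringsOfLength n, weight r s t A w v := by
  classical
  have hgeo : Summable fun n : ℕ => (2 : ℝ) ^ (t * w.length) * ((2 : ℝ) ^ (s - t)) ^ n :=
    (summable_geometric_of_lt_one (by positivity)
      (Real.rpow_lt_one_of_one_lt_of_neg one_lt_two (by linarith))).mul_left _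
  refine Summable.of_nonneg_of_le (fun n => Finset.sum_nonneg fun v _ => weight_nonneg ..)
    (fun n => ?_) hgeo
  have h1 : ∑ v ∈ stringsOfLength n, weight r s t A w v ≤
      ∑ v ∈ stringsOfLength n,
        if v ∈ A ∧ True then (2 : ℝ) ^ ((s - r - t) * n + t * w.length) else 0 := by
    refine Finset.sum_le_sum fun v hv => ?_
    rw [mem_stringsOfLength] at hv
    subst hv
    unfold weight
    by_cases hA : v ∈ A
    · rw [if_pos (show v ∈ A ∧ True from ⟨hA, trivial⟩)]
      split_ifs
      · refine Real.rpow_le_rpow_of_exponent_le one_le_two ?_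
        unfold weightExponent
        have : (0 : ℝ) ≤ ((w.length - v.length : ℕ) : ℝ) := Nat.cast_nonneg _
        linarith
      · positivity
    · simp [hA]
  refine h1.trans ?_
  rw [← ncard_eq_sum]
  have hset : {v ∈ {v ∈ A | v.length = n} | True} = {v ∈ A | v.length = n} := by simp
  rw [hset]
  refine (mul_le_mul_of_nonneg_left (hcard n) (by positivity)).trans (le_of_eq ?_)
  rw [← Real.rpow_natCast, ← Real.rpow_mul zero_le_two, ← Real.rpow_add zero_lt_two,
    ← Real.rpow_add zero_lt_two]
  congr 1
  ring

/-- A dyadic lower approximation, at stage `N`, of the weight of `v` at `w`. -/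
def approxWeight (R S T : ℕ → ℕ) (F : List Bool × ℕ → Bool) (w v : List Bool) (N : ℕ) : ℕ :=
  bif decide (w.take v.length = v.take w.length) && (List.range N).any fun j => F (v, j) then
    dyadicRoot ((S N * v.length + T N * w.length + N * 2 ^ N) -
      (R N * v.length + T N * v.length + (w.length - v.length) * 2 ^ N +
        (6 * v.length + 2 * w.length))) N
  else 0

theorem computable_approxWeight {R S T : ℕ → ℕ} {F : List Bool × ℕ → Bool} (hR : Computable R)
    (hS : Computable S) (hT : Computable T) (hF : Computable F) :
    Computable fun x : (List Bool × ℕ) × List Bool => approxWeight R S T F x.1.1 x.2 x.1.2 := by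
  have hw : Computable fun x : (List Bool × ℕ) × List Bool => x.1.1 :=
    Computable.fst.comp Computable.fst
  have hN : Computable fun x : (List Bool × ℕ) × List Bool => x.1.2 :=
    Computable.snd.comp Computable.fst
  have hv : Computable fun x : (List Bool × ℕ) × List Bool => x.2 := Computable.snd
  have hwl := Primrec.list_length.to_comp.comp hw
  have hvl := Primrec.list_length.to_comp.comp hv
  have hadd := Primrec.nat_add.to_comp
  have hmul := Primrec.nat_mul.to_comp
  have hsub := Primrec.nat_sub.to_comp
  have hpow := primrec_nat_pow.to_comp.comp (Computable.const 2) hN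
  have heq : Computable₂ fun a b : List Bool => decide (a = b) :=
    (PrimrecPred.decide (Primrec.eq (α := List Bool))).to_comp
  have htake := (Primrec.list_take (α := Bool)).to_comp
  refine Computable.cond (Primrec.and.to_comp.comp
    (heq.comp (htake.comp hvl hw) (htake.comp hwl hv))
    (computable_any_range (F := fun y : ((List Bool × ℕ) × List Bool) × ℕ => F (y.1.2, y.2))
      (hF.comp ((Computable.snd.comp Computable.fst).pair Computable.snd)) hN))
    (primrec_dyadicRoot.to_comp.comp (hsub.comp ?_ ?_) hN) (Computable.const 0)
  · exact hadd.comp (hadd.comp (hmul.comp (hS.comp hN) hvl) (hmul.comp (hT.comp hN) hwl))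
      (hmul.comp hN hpow)
  · exact hadd.comp (hadd.comp (hadd.comp (hmul.comp (hR.comp hN) hvl)
      (hmul.comp (hT.comp hN) hvl)) (hmul.comp (hsub.comp hwl hvl) hpow))
      (hadd.comp (hmul.comp (Computable.const 6) hvl) (hmul.comp (Computable.const 2) hwl))

section ApproxWeight

variable {r s t : ℝ} {R S T : ℕ → ℕ} {A : Set (List Bool)} {F : List Bool × ℕ → Bool}

theorem abs_exponent_approx_le (hR : ∀ n, |(R n : ℝ) - r * 2 ^ n| ≤ 2)
    (hS : ∀ n, |(S n : ℝ) - s * 2 ^ n| ≤ 2) (hT : ∀ n, |(T n : ℝ) - t * 2 ^ n| ≤ 2)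
    (w v : List Bool) (N : ℕ) :
    |((S N * v.length + T N * w.length + N * 2 ^ N : ℕ) : ℝ) -
      ((R N * v.length + T N * v.length + (w.length - v.length) * 2 ^ N : ℕ) : ℝ) -
        (weightExponent r s t w v + N) * 2 ^ N| ≤ 6 * v.length + 2 * w.length := by
  have key : ((S N * v.length + T N * w.length + N * 2 ^ N : ℕ) : ℝ) -
      ((R N * v.length + T N * v.length + (w.length - v.length) * 2 ^ N : ℕ) : ℝ) -
        (weightExponent r s t w v + N) * 2 ^ N =
      (S N - s * 2 ^ N) * v.length + (T N - t * 2 ^ N) * w.length -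
        (R N - r * 2 ^ N) * v.length - (T N - t * 2 ^ N) * v.length := by
    unfold weightExponent
    push_cast
    ring
  have hv : (0 : ℝ) ≤ v.length := Nat.cast_nonneg _
  have hw : (0 : ℝ) ≤ w.length := Nat.cast_nonneg _
  have hb : ∀ {x y : ℝ}, |x| ≤ 2 → 0 ≤ y → |x * y| ≤ 2 * y := fun {x y} hx hy => by
    rw [abs_mul, abs_of_nonneg hy]
    exact mul_le_mul_of_nonneg_right hx hy
  have h1 := abs_le.1 (hb (hS N) hv)
  have h2 := abs_le.1 (hb (hT N) hw)
  have h3 := abs_le.1 (hb (hR N) hv)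
  have h4 := abs_le.1 (hb (hT N) hv)
  rw [key, abs_le]
  constructor <;> linarith [h1.1, h1.2, h2.1, h2.2, h3.1, h3.2, h4.1, h4.2]

theorem approxWeight_div_le (hR : ∀ n, |(R n : ℝ) - r * 2 ^ n| ≤ 2)
    (hS : ∀ n, |(S n : ℝ) - s * 2 ^ n| ≤ 2) (hT : ∀ n, |(T n : ℝ) - t * 2 ^ n| ≤ 2)
    (hF : ∀ w : List Bool, w ∈ A ↔ ∃ k : ℕ, F (w, k) = true)
    (w v : List Bool) (N : ℕ) :
    (approxWeight R S T F w v N : ℝ) / 2 ^ N ≤ weight r s t A w v := by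
  unfold approxWeight
  cases hc : (decide (w.take v.length = v.take w.length) &&
      (List.range N).any fun j => F (v, j))
  · simpa using weight_nonneg r s t A w v
  · simp only [Bool.and_eq_true, decide_eq_true_eq, List.any_eq_true] at hc
    obtain ⟨hp, j, -, hj⟩ := hc
    rw [weight, if_pos ⟨(hF v).2 ⟨j, hj⟩, hp⟩, cond_true]
    refine dyadicRoot_div_le ?_
    have := (abs_le.1 (abs_exponent_approx_le hR hS hT w v N)).2
    push_cast at this ⊢
    linarith

theorem tendsto_approxWeight_div (hR : ∀ n, |(R n : ℝ) - r * 2 ^ n| ≤ 2)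
    (hS : ∀ n, |(S n : ℝ) - s * 2 ^ n| ≤ 2) (hT : ∀ n, |(T n : ℝ) - t * 2 ^ n| ≤ 2)
    (hF : ∀ w : List Bool, w ∈ A ↔ ∃ k : ℕ, F (w, k) = true)
    (w v : List Bool) :
    Tendsto (fun N => (approxWeight R S T F w v N : ℝ) / 2 ^ N) atTop
      (nhds (weight r s t A w v)) := by
  by_cases hA : v ∈ A ∧ w.take v.length = v.take w.length
  · obtain ⟨j, hj⟩ := (hF v).1 hA.1
    rw [weight, if_pos hA]
    refine Tendsto.congr' ?_ (tendsto_dyadicRoot_div (C := 2 * (6 * v.length + 2 * w.length))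
      (P := fun N => S N * v.length + T N * w.length + N * 2 ^ N)
      (Q := fun N => R N * v.length + T N * v.length + (w.length - v.length) * 2 ^ N +
        (6 * v.length + 2 * w.length)) (fun N => ?_) (fun N => ?_))
    · filter_upwards [eventually_gt_atTop j] with N hN
      have hany : ((List.range N).any fun j => F (v, j)) = true :=
        List.any_eq_true.2 ⟨j, List.mem_range.2 hN, hj⟩
      simp only [approxWeight, hA.2, hany, decide_true, Bool.and_self, cond_true]
    · have := (abs_le.1 (abs_exponent_approx_le hR hS hT w v N)).2
      push_cast at this ⊢
      linarith
    · have := (abs_le.1 (abs_exponent_approx_le hR hS hT w v N)).1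
      push_cast at this ⊢
      linarith
  · have h0 : weight r s t A w v = 0 := if_neg hA
    rw [h0]
    refine tendsto_const_nhds.congr fun N => le_antisymm (by positivity) ?_
    exact (approxWeight_div_le hR hS hT hF w v N).trans h0.le

end ApproxWeight

/-- For computable reals `0 ≤ r < s < t` and a computably enumerable set `A`
with `|A_{=n}| ≤ 2 ^ (r * n)`, the `t`-gale
`d' = ∑' n, 2 ^ ((s-r)*n) * dF t n A_{=n}` is constructive. -/
theorem sum_dF_constructive (r s t : ℝ) (hr : 0 ≤ r) (hrs : r < s) (hst : s < t)
    (hcr : ComputableReal r) (hcs : ComputableReal s) (hct : ComputableReal t)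
    (A : Set (List Bool))
    (hce : ∃ F : List Bool × ℕ → Bool, Computable F ∧
      ∀ w : List Bool, w ∈ A ↔ ∃ k : ℕ, F (w, k) = true)
    (hcard : ∀ n : ℕ, (({w ∈ A | w.length = n}).ncard : ℝ) ≤ 2 ^ (r * n)) :
    Constructive (fun w =>
      ∑' n : ℕ, 2 ^ ((s - r) * n) * dF t n {v ∈ A | v.length = n} w) := by
  obtain ⟨R, hRc, hR⟩ := hcr.exists_nat_approx hr
  obtain ⟨S, hSc, hS⟩ := hcs.exists_nat_approx (hr.trans hrs.le)
  obtain ⟨T, hTc, hT⟩ := hct.exists_nat_approx ((hr.trans hrs.le).trans hst.le)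
  obtain ⟨F, hFc, hF⟩ := hce
  have hsum : ∀ w, Summable (weight r s t A w) := fun w =>
    summable_of_summable_length (weight_nonneg r s t A w) (summable_sum_weight hst hcard w)
  simp only [mul_dF_eq_sum_weight, tsum_sum_stringsOfLength (hsum _)]
  refine constructive_of_dyadic_approx
    (T := fun x => sumCodesLT (fun v => approxWeight R S T F x.1 v x.2) x.2)
    (computable_sumCodesLT (computable_approxWeight hRc hSc hTc hFc).to₂ Computable.snd)
    (fun w N => ?_) (fun w ε hε => ?_)
  · exact sumCodesLT_div_le (hsum w) (weight_nonneg r s t A w)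
      (approxWeight_div_le hR hS hT hF w) N
  · exact exists_lt_sumCodesLT_div (hsum w) (tendsto_approxWeight_div hR hS hT hF w) hε
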